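/- Let φ_σ = φ̂_σ be the hat kernel, let ω > 0, let z ∈ ℬ_ω^{ij} for some i, j ∈ {0,1}, set f_σ = φ̂_σ * z, and let λ > 0. If σ ≤ ω/2 and 2/λ + (21/15)σ < ω, then u = z is the unique minimiser of F₂(u) = ∫_ℝ |u′| + λ‖φ̂_σ*u − f_σ‖²_{L²(ℝ)} over ℬ^{ij}, i.e. F₂(z) < F₂(u) for every u ∈ ℬ^{ij} with u ≠ z a.e. -/

import Mathlib

open MeasureTheory Set

noncomputable section

/-- The total variation `∫_ℝ |u'|` of a function `u : ℝ → ℝ`. -/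
def TV (u : ℝ → ℝ) : ENNReal := eVariationOn u Set.univ

/-- Convolution `(φ * u)(x) = ∫_ℝ φ(x − y) u(y) dy`. -/
def conv (φ u : ℝ → ℝ) : ℝ → ℝ := fun x => ∫ y : ℝ, φ (x - y) * u y

/-- Membership of `φ` in the kernel class `𝒦`, with parameter `σ` and profile `p`:
`φ(x) = p(|x|) χ_{[−σ,σ]}(x)` with `p ≥ 0` monotonically decreasing on `[0,σ]`
and `∫₀^σ p = 1/2`; in particular `φ ∈ L¹(ℝ)`. -/
def IsKernelWith (φ : ℝ → ℝ) (p : ℝ → ℝ) (σ : ℝ) : Prop :=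
  0 < σ ∧ Integrable φ ∧
    (∀ x ∈ Icc (0:ℝ) σ, 0 ≤ p x) ∧ AntitoneOn p (Icc (0:ℝ) σ) ∧
    (∫ x in (0:ℝ)..σ, p x) = 1 / 2 ∧
    ∀ x : ℝ, φ x = if |x| ≤ σ then p |x| else 0

/-- The hat kernel `φ̂_σ(x) = (1 − |x|/σ)/σ` for `|x| < σ`, `0` otherwise. -/
def hatKernel (σ : ℝ) : ℝ → ℝ := fun x => if |x| < σ then (1 - |x| / σ) / σ else 0

/-- The dual norm `‖f‖_* = sup { |∫ f v| : v ∈ L¹(ℝ), ∫_ℝ |v'| ≤ 1 }`. -/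
def starNorm (f : ℝ → ℝ) : ENNReal :=
  ⨆ (v : ℝ → ℝ) (_ : Integrable v ∧ TV v ≤ 1), ENNReal.ofReal |∫ x : ℝ, f x * v x|

/-- Structural description of a bar code: `n` bars with interface points
`t 0 < t 1 < ⋯ < t (2n−1)` inside `[0,1]`; the bars are the intervals
`[t (2k), t (2k+1)]`, `k < n`. -/
structure BarcodeRep where
  n : ℕ
  t : ℕ → ℝ
  mono : StrictMonoOn t (Set.Iio (2 * n))
  left : n ≠ 0 → 0 ≤ t 0
  right : n ≠ 0 → t (2 * n - 1) ≤ 1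

/-- The support of a bar code: the union of its (closed) bars. -/
def BarcodeRep.supp (B : BarcodeRep) : Set ℝ :=
  ⋃ k ∈ Finset.range B.n, Icc (B.t (2 * k)) (B.t (2 * k + 1))

/-- The bar code as a function: the characteristic function of the union of its bars. -/
def BarcodeRep.fn (B : BarcodeRep) : ℝ → ℝ := B.supp.indicator fun _ => (1:ℝ)

/-- `x` is an interface location (an endpoint of a bar) of the bar code `B`. -/
def BarcodeRep.IsInterface (B : BarcodeRep) (x : ℝ) : Prop := ∃ k < 2 * B.n, B.t k = x

/-- All bars and all (maximal, nonempty) spaces in `[0,1]` of the bar code `B`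
have width at least `ω`. -/
def BarcodeRep.MinWidth (B : BarcodeRep) (ω : ℝ) : Prop :=
  (∀ k < B.n, ω ≤ B.t (2 * k + 1) - B.t (2 * k)) ∧
  (∀ k, k + 1 < B.n → ω ≤ B.t (2 * k + 2) - B.t (2 * k + 1)) ∧
  (B.n ≠ 0 → 0 < B.t 0 → ω ≤ B.t 0) ∧
  (B.n ≠ 0 → B.t (2 * B.n - 1) < 1 → ω ≤ 1 - B.t (2 * B.n - 1))

/-- Membership in `ℬ`: `u` is (the standard representative of) a bar code. -/
def IsBarcode (u : ℝ → ℝ) : Prop := ∃ B : BarcodeRep, u = B.fn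

/-- Membership in `ℬ_ω`. -/
def IsBarcodeW (u : ℝ → ℝ) (ω : ℝ) : Prop := ∃ B : BarcodeRep, u = B.fn ∧ B.MinWidth ω

/-- Membership in `ℬ^{ij}`: `u = i` on `[0,x₁]` and `u = j` on `[x₂,1]` for some
`0 < x₁ ≤ x₂ < 1`. -/
def InBij (u : ℝ → ℝ) (i j : ℝ) : Prop :=
  ∃ x₁ x₂ : ℝ, 0 < x₁ ∧ x₁ ≤ x₂ ∧ x₂ < 1 ∧
    (∀ x ∈ Icc (0:ℝ) x₁, u x = i) ∧ (∀ x ∈ Icc x₂ (1:ℝ), u x = j)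

/-- The `L²` fidelity term `‖g − f‖²_{L²(ℝ)}`, valued in `[0,∞]`
(equal to `∞` if `g − f ∉ L²(ℝ)`). -/
def fidelity (g f : ℝ → ℝ) : ENNReal := ∫⁻ x : ℝ, ENNReal.ofReal ((g x - f x) ^ 2)

/-- The functional `F₁(u) = ∫_ℝ |u'| + λ ‖u − f‖²_{L²(ℝ)}`. -/
def F1 (lam : ℝ) (f u : ℝ → ℝ) : ENNReal := TV u + ENNReal.ofReal lam * fidelity u f

/-- The (blind) deconvolution functional `F(u) = ∫_ℝ |u'| + λ ‖φ*u − f‖²_{L²(ℝ)}`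
(this is `F₂` when `φ = φ_σ` and `F₃` when `φ = φ_ρ`). -/
def Fker (lam : ℝ) (φ f u : ℝ → ℝ) : ENNReal :=
  TV u + ENNReal.ofReal lam * fidelity (conv φ u) f


theorem hat_eq (σ : ℝ) (hσ : 0 < σ) : hatKernel σ = fun x => max 0 ((1 - |x| / σ) / σ) := by
  funext x
  unfold hatKernel
  split_ifs with h
  · rw [max_eq_right]
    have : |x| / σ < 1 := (div_lt_one hσ).2 h
    apply div_nonneg _ hσ.le
    linarith
  · rw [max_eq_left]
    have : 1 ≤ |x| / σ := (one_le_div hσ).2 (not_lt.1 h)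
    apply div_nonpos_of_nonpos_of_nonneg _ hσ.le
    linarith

theorem hat_cont (σ : ℝ) (hσ : 0 < σ) : Continuous (hatKernel σ) := by
  rw [hat_eq σ hσ]
  fun_prop

theorem hat_nonneg (σ : ℝ) (hσ : 0 < σ) (x : ℝ) : 0 ≤ hatKernel σ x := by
  rw [hat_eq σ hσ]
  exact le_max_left _ _

theorem hat_pos (σ x : ℝ) (hσ : 0 < σ) (h : |x| < σ) : 0 < hatKernel σ x := by
  unfold hatKernel
  rw [if_pos h]
  have : |x| / σ < 1 := (div_lt_one hσ).2 h
  apply div_pos _ hσ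
  linarith

theorem hat_zero (σ x : ℝ) (h : σ ≤ |x|) : hatKernel σ x = 0 := by
  unfold hatKernel
  rw [if_neg (not_lt.2 h)]

theorem hat_even (σ x : ℝ) : hatKernel σ (-x) = hatKernel σ x := by
  unfold hatKernel
  rw [abs_neg]

theorem hat_compact (σ : ℝ) : HasCompactSupport (hatKernel σ) := by
  apply HasCompactSupport.intro (isCompact_Icc (a := -σ) (b := σ))
  intro x hx
  apply hat_zero
  by_contra h
  rw [not_le, abs_lt] at h
  exact hx ⟨h.1.le, h.2.le⟩

theorem hat_integrable (σ : ℝ) (hσ : 0 < σ) : Integrable (hatKernel σ) :=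
  (hat_cont σ hσ).integrable_of_hasCompactSupport (hat_compact σ)

theorem hat_half (σ m : ℝ) (hσ : 0 < σ) (h0 : 0 ≤ m) (hm : m ≤ σ) :
    ∫ t in (0:ℝ)..m, hatKernel σ t = m / σ - m ^ 2 / (2 * σ ^ 2) := by
  have : ∫ t in (0:ℝ)..m, hatKernel σ t = ∫ t in (0:ℝ)..m, (1 - t / σ) / σ := by
    apply intervalIntegral.integral_congr
    intro t ht
    rw [uIcc_of_le h0] at ht
    simp only
    rw [hat_eq σ hσ]
    simp only
    rw [abs_of_nonneg ht.1, max_eq_right]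
    have : t / σ ≤ 1 := (div_le_one hσ).2 (ht.2.trans hm)
    apply div_nonneg _ hσ.le
    linarith
  rw [this, intervalIntegral.integral_div, intervalIntegral.integral_sub (by simp) (by
    apply Continuous.intervalIntegrable; fun_prop), intervalIntegral.integral_div]
  simp
  field_simp

theorem hat_two (σ p q : ℝ) (hσ : 0 < σ) (h0 : 0 ≤ p) (hm : p ≤ σ) (h0' : 0 ≤ q) (hm' : q ≤ σ) :
    ∫ t in (-p)..q, hatKernel σ t =
      (p / σ - p ^ 2 / (2 * σ ^ 2)) + (q / σ - q ^ 2 / (2 * σ ^ 2)) := by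
  have hi : ∀ a b, IntervalIntegrable (hatKernel σ) volume a b :=
    fun a b => (hat_cont σ hσ).intervalIntegrable a b
  rw [← intervalIntegral.integral_add_adjacent_intervals (hi (-p) 0) (hi 0 q), hat_half σ q hσ h0' hm']
  congr 1
  rw [← hat_half σ p hσ h0 hm]
  have := intervalIntegral.integral_comp_neg (a := 0) (b := p) (hatKernel σ)
  simp only [hat_even, neg_zero] at this
  exact this.symm

theorem hat_total (σ : ℝ) (hσ : 0 < σ) : ∫ t, hatKernel σ t = 1 := by
  have h := hat_two σ σ σ hσ hσ.le le_rfl hσ.le le_rfl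
  rw [intervalIntegral.integral_eq_integral_of_support_subset] at h
  · rw [h]; field_simp; norm_num
  · intro x hx
    have : |x| < σ := by
      by_contra hc
      exact hx (hat_zero σ x (not_lt.1 hc))
    rw [abs_lt] at this
    exact ⟨this.1, this.2.le⟩

theorem hat_shift_integrable (σ x : ℝ) (hσ : 0 < σ) : Integrable (fun y => hatKernel σ (x - y)) :=
  (hat_integrable σ hσ).comp_sub_left x

theorem hat_mul_integrable (σ x : ℝ) (hσ : 0 < σ) (v : ℝ → ℝ) (hv : Measurable v)
    (hb : ∀ y, |v y| ≤ 1) : Integrable (fun y => hatKernel σ (x - y) * v y) := by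
  apply (hat_shift_integrable σ x hσ).mul_bdd (c := 1) hv.aestronglyMeasurable
  exact Filter.Eventually.of_forall hb

/-- lower bound on mass of the kernel inside an interval -/
theorem hat_mass (σ a b x : ℝ) (hσ : 0 < σ) (hab : 2 * σ ≤ b - a) (hx : x ∈ Ioo a b) :
    (1 + min 1 (min ((x - a) / σ) ((b - x) / σ))) / 2 ≤ ∫ y in Ioo a b, hatKernel σ (x - y) := by
  obtain ⟨h1, h2⟩ := hx
  set p := min σ (x - a) with hp
  set q := min σ (b - x) with hq
  have hp0 : 0 < p := lt_min hσ (by linarith)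
  have hq0 : 0 < q := lt_min hσ (by linarith)
  have hpσ : p ≤ σ := min_le_left _ _
  have hqσ : q ≤ σ := min_le_left _ _
  have hpa : p ≤ x - a := min_le_right _ _
  have hqb : q ≤ b - x := min_le_right _ _
  have e1 : ∫ y in Ioo (x - p) (x + q), hatKernel σ (x - y) =
      (p / σ - p ^ 2 / (2 * σ ^ 2)) + (q / σ - q ^ 2 / (2 * σ ^ 2)) := by
    rw [← integral_Ioc_eq_integral_Ioo, ← intervalIntegral.integral_of_le (by linarith),
      intervalIntegral.integral_comp_sub_left (hatKernel σ)]
    have := hat_two σ q p hσ hq0.le hqσ hp0.le hpσ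
    rw [show x - (x + q) = -q by ring, show x - (x - p) = p by ring, this]
    ring
  have e2 : ∫ y in Ioo (x - p) (x + q), hatKernel σ (x - y) ≤ ∫ y in Ioo a b, hatKernel σ (x - y) := by
    apply setIntegral_mono_set (hat_shift_integrable σ x hσ).integrableOn
    · exact Filter.Eventually.of_forall fun y => hat_nonneg σ hσ _
    · exact (Ioo_subset_Ioo (by linarith) (by linarith)).eventuallyLE
  refine le_trans ?_ (e1 ▸ e2)
  have key : ∀ m, 0 ≤ m → m ≤ σ → m / σ / 2 ≤ m / σ - m ^ 2 / (2 * σ ^ 2) := by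
    intro m h0 hm
    have e : m / σ - m ^ 2 / (2 * σ ^ 2) = m / σ - (m / σ) ^ 2 / 2 := by field_simp
    have : m / σ ≤ 1 := (div_le_one hσ).2 hm
    have : 0 ≤ m / σ := by positivity
    rw [e]; nlinarith
  have full : σ / σ - σ ^ 2 / (2 * σ ^ 2) = 1 / 2 := by field_simp; norm_num
  have hps : min 1 (min ((x - a) / σ) ((b - x) / σ)) ≤ p / σ := by
    rw [hp, le_div_iff₀ hσ, le_min_iff]
    constructor
    · have := min_le_left 1 (min ((x - a) / σ) ((b - x) / σ))
      nlinarith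
    · rw [← le_div_iff₀ hσ]
      exact (min_le_right _ _).trans (min_le_left _ _)
  have hqs : min 1 (min ((x - a) / σ) ((b - x) / σ)) ≤ q / σ := by
    rw [hq, le_div_iff₀ hσ, le_min_iff]
    constructor
    · have := min_le_left 1 (min ((x - a) / σ) ((b - x) / σ))
      nlinarith
    · rw [← le_div_iff₀ hσ]
      exact (min_le_right _ _).trans (min_le_right _ _)
  rcases le_total σ (x - a) with h | h
  · have : p = σ := min_eq_left h
    rw [this, full]
    have := key q hq0.le hqσ
    linarith
  · have : q = σ := min_eq_left (by linarith)
    rw [this, full]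
    have := key p hp0.le hpσ
    linarith

theorem conv_lower (σ a b x s : ℝ) (hσ : 0 < σ) (hab : 2 * σ ≤ b - a) (hx : x ∈ Ioo a b)
    (v : ℝ → ℝ) (hv : Measurable v) (hb : ∀ y, |v y| ≤ 1) (hs : s = 1 ∨ s = -1)
    (hvs : ∀ y ∈ Ioo a b, v y = s) :
    min 1 (min ((x - a) / σ) ((b - x) / σ)) ≤ s * ∫ y, hatKernel σ (x - y) * v y := by
  have hm := hat_mass σ a b x hσ hab hx
  have h1 : ∫ y, hatKernel σ (x - y) = 1 := by
    rw [integral_sub_left_eq_self (hatKernel σ) volume x, hat_total σ hσ]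
  rw [← integral_indicator measurableSet_Ioo] at hm
  have hI := (hat_shift_integrable σ x hσ)
  have hI2 := hI.indicator (measurableSet_Ioo (a := a) (b := b))
  have : ∫ y, (2 * (Ioo a b).indicator (fun y => hatKernel σ (x - y)) y - hatKernel σ (x - y)) ≤
      ∫ y, s * (hatKernel σ (x - y) * v y) := by
    apply integral_mono ((hI2.const_mul 2).sub hI) ((hat_mul_integrable σ x hσ v hv hb).const_mul s)
    intro y
    change 2 * (Ioo a b).indicator (fun y => hatKernel σ (x - y)) y - hatKernel σ (x - y) ≤
      s * (hatKernel σ (x - y) * v y)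
    have hn := hat_nonneg σ hσ (x - y)
    by_cases hy : y ∈ Ioo a b
    · rw [indicator_of_mem hy, hvs y hy]
      rcases hs with rfl | rfl <;> linarith
    · rw [indicator_of_notMem hy]
      have := abs_le.1 (hb y)
      rcases hs with rfl | rfl <;> nlinarith
  rw [integral_sub (hI2.const_mul 2) hI, integral_const_mul, integral_const_mul, h1] at this
  linarith

theorem g_int (σ a b : ℝ) (hσ : 0 < σ) (hab : 2 * σ ≤ b - a) :
    b - a - 4 / 3 * σ ≤ ∫ x in a..b, (min 1 (min ((x - a) / σ) ((b - x) / σ))) ^ 2 := by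
  set g : ℝ → ℝ := fun x => (min 1 (min ((x - a) / σ) ((b - x) / σ))) ^ 2 with hg
  have hc : Continuous g := by fun_prop
  have hi : ∀ a b, IntervalIntegrable g volume a b := fun a b => hc.intervalIntegrable a b
  rw [← intervalIntegral.integral_add_adjacent_intervals (hi a (a+σ)) (hi (a+σ) b),
    ← intervalIntegral.integral_add_adjacent_intervals (hi (a+σ) (b-σ)) (hi (b-σ) b)]
  have e1 : ∫ x in a..(a+σ), g x = σ / 3 := by
    have : ∫ x in a..(a+σ), g x = ∫ x in a..(a+σ), (fun t => t^2 / σ^2) (x - a) := by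
      apply intervalIntegral.integral_congr
      intro x hx
      rw [uIcc_of_le (by linarith)] at hx
      simp only [hg]
      rw [min_eq_left (a := (x-a)/σ), min_eq_right]
      · rw [div_pow]
      · rw [div_le_one hσ]; linarith [hx.2]
      · apply div_le_div_of_nonneg_right _ hσ.le; linarith [hx.2]
    rw [this, intervalIntegral.integral_comp_sub_right (fun t => t^2 / σ^2),
      intervalIntegral.integral_div, integral_pow]
    field_simp; ring
  have e3 : ∫ x in (b-σ)..b, g x = σ / 3 := by
    have : ∫ x in (b-σ)..b, g x = ∫ x in (b-σ)..b, (fun t => t^2 / σ^2) (b - x) := by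
      apply intervalIntegral.integral_congr
      intro x hx
      rw [uIcc_of_le (by linarith)] at hx
      simp only [hg]
      rw [min_eq_right (a := (x-a)/σ), min_eq_right]
      · rw [div_pow]
      · rw [div_le_one hσ]; linarith [hx.1]
      · apply div_le_div_of_nonneg_right _ hσ.le; linarith [hx.1]
    rw [this, intervalIntegral.integral_comp_sub_left (fun t => t^2 / σ^2),
      intervalIntegral.integral_div, integral_pow]
    field_simp; ring
  have e2 : ∫ x in (a+σ)..(b-σ), g x = b - σ - (a + σ) := by
    have : ∫ x in (a+σ)..(b-σ), g x = ∫ x in (a+σ)..(b-σ), (1:ℝ) := by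
      apply intervalIntegral.integral_congr
      intro x hx
      rw [uIcc_of_le (by linarith)] at hx
      simp only [hg]
      rw [min_eq_left]
      · norm_num
      · rw [le_min_iff, le_div_iff₀ hσ, le_div_iff₀ hσ]
        constructor <;> linarith [hx.1, hx.2]
    rw [this]; simp
  rw [e1, e2, e3]; linarith

theorem fid_piece (σ a b s : ℝ) (hσ : 0 < σ) (hab : 2 * σ ≤ b - a)
    (v : ℝ → ℝ) (hv : Measurable v) (hb : ∀ y, |v y| ≤ 1) (hs : s = 1 ∨ s = -1)
    (hvs : ∀ y ∈ Ioo a b, v y = s) :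
    ENNReal.ofReal (b - a - 4 / 3 * σ) ≤
      ∫⁻ x in Ioo a b, ENNReal.ofReal ((∫ y, hatKernel σ (x - y) * v y) ^ 2) := by
  have h := g_int σ a b hσ hab
  rw [intervalIntegral.integral_of_le (by linarith), integral_Ioc_eq_integral_Ioo] at h
  refine (ENNReal.ofReal_le_ofReal h).trans ?_
  rw [ofReal_integral_eq_lintegral_ofReal]
  · apply setLIntegral_mono' measurableSet_Ioo
    intro x hx
    apply ENNReal.ofReal_le_ofReal
    have h1 := conv_lower σ a b x s hσ hab hx v hv hb hs hvs
    have h0 : 0 ≤ min 1 (min ((x - a) / σ) ((b - x) / σ)) := by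
      have := hx.1
      have := hx.2
      refine le_min zero_le_one (le_min ?_ ?_) <;> apply div_nonneg _ hσ.le <;> linarith
    have h2 := pow_le_pow_left₀ h0 h1 2
    have : s ^ 2 = 1 := by rcases hs with rfl | rfl <;> norm_num
    rwa [mul_pow, this, one_mul] at h2
  · apply Continuous.integrableOn_Ioc (b := b) (a := a) (by fun_prop) |>.mono_set Ioo_subset_Ioc_self
  · exact Filter.Eventually.of_forall fun x => sq_nonneg _

theorem fid_pos (σ : ℝ) (hσ : 0 < σ) (v : ℝ → ℝ) (hv : Measurable v)
    (hc : ∀ a : ℝ, ∃ c, ∀ᶠ x in nhdsWithin a (Ioi a), v x = c)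
    (h0 : ∀ x < 0, v x = 0) (h1 : ∀ x, 1 < x → v x = 0) (hne : ¬ ∀ᵐ x, v x = 0) :
    0 < ∫⁻ x, ENNReal.ofReal ((∫ y, hatKernel σ (x - y) * v y) ^ 2) := by
  set S : Set ℝ := {x | ∀ᵐ y, y < x → v y = 0} with hS
  have hS0 : S.Nonempty := ⟨0, by
    have : ∀ᵐ y : ℝ, y < 0 → v y = 0 := Filter.Eventually.of_forall h0
    simpa [hS] using this⟩
  have hSb : BddAbove S := by
    refine ⟨2, fun x hx => ?_⟩
    by_contra hlt
    apply hne
    filter_upwards [hx] with y hy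
    rcases lt_or_ge y x with h | h
    · exact hy h
    · exact h1 y (by linarith)
  set a := sSup S with ha
  have haS : ∀ᵐ y, y < a → v y = 0 := by
    obtain ⟨w, -, hw, hwS⟩ := exists_seq_tendsto_sSup hS0 hSb
    have := ae_all_iff.2 (fun n => hwS n)
    filter_upwards [this] with y hy hya
    obtain ⟨n, hn⟩ := (hw.eventually (lt_mem_nhds hya)).exists
    exact hy n hn
  obtain ⟨c, hca⟩ := hc a
  rw [eventually_nhdsWithin_iff, Metric.eventually_nhds_iff] at hca
  obtain ⟨ε, hε, hvc⟩ := hca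
  replace hvc : ∀ y ∈ Ioo a (a + ε), v y = c := by
    intro y hy
    apply hvc _ hy.1
    rw [Real.dist_eq, abs_of_pos] <;> linarith [hy.1, hy.2]
  have hc0 : c ≠ 0 := by
    rintro rfl
    have : a + ε ∈ S := by
      have hna : ∀ᵐ y : ℝ, y ≠ a := by simp [ae_iff]
      filter_upwards [haS, hna] with y hy hy2 hy3
      rcases lt_or_gt_of_ne hy2 with h | h
      · exact hy h
      · exact hvc y ⟨h, hy3⟩
    have := le_csSup hSb this
    linarith
  have hpos : ∀ x ∈ Ioo (a - σ) (a - σ + min ε σ), (∫ y, hatKernel σ (x - y) * v y) ≠ 0 := by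
    intro x hx
    have hx1 := hx.1
    have hx2 : x < a - σ + ε := hx.2.trans_le (by gcongr; exact min_le_left _ _)
    have hx3 : x < a - σ + σ := hx.2.trans_le (by gcongr; exact min_le_right _ _)
    have e : (∫ y, hatKernel σ (x - y) * v y) = ∫ y in Ioo a (x + σ), hatKernel σ (x - y) * c := by
      rw [← integral_indicator measurableSet_Ioo]
      apply integral_congr_ae
      have hna : ∀ᵐ y : ℝ, y ≠ a := by simp [ae_iff]
      filter_upwards [haS, hna] with y hy hy2
      rcases lt_or_gt_of_ne hy2 with h | h
      · rw [hy h, indicator_of_notMem (fun h' => absurd h'.1 (not_lt.2 h.le)), mul_zero]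
      · by_cases hyx : y < x + σ
        · rw [indicator_of_mem (show y ∈ Ioo a (x + σ) from ⟨h, hyx⟩), hvc y ⟨h, by linarith⟩]
        · rw [indicator_of_notMem (fun h' => hyx h'.2), hat_zero, zero_mul]
          rw [abs_sub_comm]
          apply le_trans _ (le_abs_self _)
          linarith [not_lt.1 hyx]
    rw [e, integral_mul_const]
    apply mul_ne_zero _ hc0
    apply ne_of_gt
    rw [← integral_Ioc_eq_integral_Ioo, ← intervalIntegral.integral_of_le (by linarith)]
    apply intervalIntegral.intervalIntegral_pos_of_pos_on
    · exact ((hat_cont σ hσ).comp (by fun_prop)).intervalIntegrable _ _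
    · intro y hy
      apply hat_pos _ _ hσ
      rw [abs_lt]
      constructor <;> linarith [hy.1, hy.2]
    · linarith
  rw [pos_iff_ne_zero]
  intro hz
  have hmeas : Measurable (fun x => ENNReal.ofReal ((∫ y, hatKernel σ (x - y) * v y) ^ 2)) := by
    have : StronglyMeasurable (fun x => ∫ y, hatKernel σ (x - y) * v y) := by
      apply StronglyMeasurable.integral_prod_right' (f := fun p : ℝ × ℝ => hatKernel σ (p.1 - p.2) * v p.2)
      apply Measurable.stronglyMeasurable
      have := (hat_cont σ hσ).measurable
      fun_prop
    exact (this.measurable.pow_const 2).ennreal_ofReal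
  rw [lintegral_eq_zero_iff hmeas] at hz
  have : volume (Ioo (a - σ) (a - σ + min ε σ)) = 0 := by
    apply measure_mono_null _ (ae_iff.1 hz)
    intro x hx
    simp only [mem_ofPred_eq, Pi.zero_apply, ENNReal.ofReal_eq_zero, not_le]
    have := hpos x hx
    positivity
  rw [Real.volume_Ioo, ENNReal.ofReal_eq_zero] at this
  have := lt_min hε hσ
  linarith

theorem BarcodeRep.mem_supp (B : BarcodeRep) (x : ℝ) :
    x ∈ B.supp ↔ ∃ k < B.n, B.t (2 * k) ≤ x ∧ x ≤ B.t (2 * k + 1) := by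
  simp only [BarcodeRep.supp, mem_iUnion, Finset.mem_range, mem_Icc, exists_prop]

theorem BarcodeRep.fn_of_mem (B : BarcodeRep) {x : ℝ} (h : x ∈ B.supp) : B.fn x = 1 := by
  simp [BarcodeRep.fn, h]

theorem BarcodeRep.fn_of_notMem (B : BarcodeRep) {x : ℝ} (h : x ∉ B.supp) : B.fn x = 0 := by
  simp [BarcodeRep.fn, h]

theorem BarcodeRep.fn_cases (B : BarcodeRep) (x : ℝ) : B.fn x = 0 ∨ B.fn x = 1 := by
  by_cases h : x ∈ B.supp
  · exact Or.inr (B.fn_of_mem h)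
  · exact Or.inl (B.fn_of_notMem h)

theorem BarcodeRep.t_le (B : BarcodeRep) {k l : ℕ} (h : k ≤ l) (hl : l < 2 * B.n) :
    B.t k ≤ B.t l :=
  B.mono.monotoneOn (show k ∈ Iio (2 * B.n) from lt_of_le_of_lt h hl) (show l ∈ Iio (2 * B.n) from hl) h

theorem BarcodeRep.t_lt (B : BarcodeRep) {k l : ℕ} (h : k < l) (hl : l < 2 * B.n) :
    B.t k < B.t l :=
  B.mono (show k ∈ Iio (2 * B.n) from lt_trans h hl) (show l ∈ Iio (2 * B.n) from hl) h

theorem BarcodeRep.t_nonneg (B : BarcodeRep) {k : ℕ} (hk : k < 2 * B.n) : 0 ≤ B.t k :=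
  (B.left (by omega)).trans (B.t_le (Nat.zero_le k) hk)

theorem BarcodeRep.t_le_one (B : BarcodeRep) {k : ℕ} (hk : k < 2 * B.n) : B.t k ≤ 1 :=
  (B.t_le (show k ≤ 2 * B.n - 1 by omega) (by omega)).trans (B.right (by omega))

theorem BarcodeRep.fn_neg (B : BarcodeRep) {x : ℝ} (h : x < 0) : B.fn x = 0 := by
  apply B.fn_of_notMem
  rw [B.mem_supp]
  rintro ⟨k, hk, h1, h2⟩
  have := B.t_nonneg (show 2 * k < 2 * B.n by omega)
  linarith

theorem BarcodeRep.fn_gt (B : BarcodeRep) {x : ℝ} (h : 1 < x) : B.fn x = 0 := by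
  apply B.fn_of_notMem
  rw [B.mem_supp]
  rintro ⟨k, hk, h1, h2⟩
  have := B.t_le_one (show 2 * k + 1 < 2 * B.n by omega)
  linarith

theorem BarcodeRep.measurable_fn (B : BarcodeRep) : Measurable B.fn := by
  apply measurable_const.indicator
  exact Finset.measurableSet_biUnion _ fun k _ => measurableSet_Icc

theorem BarcodeRep.fn_right (B : BarcodeRep) (a : ℝ) :
    ∃ c, ∀ᶠ x in nhdsWithin a (Ioi a), B.fn x = c := by
  have key : ∀ s : ℝ, (∀ᶠ x in nhdsWithin a (Ioi a), s ≤ x ∧ s < x) ∨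
      (∀ᶠ x in nhdsWithin a (Ioi a), x < s) := by
    intro s
    rcases le_or_gt s a with h | h
    · left
      filter_upwards [self_mem_nhdsWithin] with x hx
      have : a < x := hx
      exact ⟨by linarith, by linarith⟩
    · right
      exact nhdsWithin_le_nhds (gt_mem_nhds h)
  have key2 : ∀ k, (∀ᶠ x in nhdsWithin a (Ioi a), B.t (2 * k) ≤ x ∧ x ≤ B.t (2 * k + 1)) ∨
      (∀ᶠ x in nhdsWithin a (Ioi a), ¬ (B.t (2 * k) ≤ x ∧ x ≤ B.t (2 * k + 1))) := by
    intro k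
    rcases key (B.t (2 * k)) with h1 | h1
    · rcases key (B.t (2 * k + 1)) with h2 | h2
      · right
        filter_upwards [h2] with x hx h
        linarith [h.2, hx.2]
      · left
        filter_upwards [h1, h2] with x hx1 hx2
        exact ⟨hx1.1, hx2.le⟩
    · right
      filter_upwards [h1] with x hx h
      linarith [h.1]
  by_cases hex : ∃ k < B.n, ∀ᶠ x in nhdsWithin a (Ioi a), B.t (2 * k) ≤ x ∧ x ≤ B.t (2 * k + 1)
  · obtain ⟨k, hk, h⟩ := hex
    refine ⟨1, ?_⟩
    filter_upwards [h] with x hx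
    exact B.fn_of_mem ((B.mem_supp x).2 ⟨k, hk, hx⟩)
  · refine ⟨0, ?_⟩
    have : ∀ᶠ x in nhdsWithin a (Ioi a), ∀ k ∈ Finset.range B.n,
        ¬ (B.t (2 * k) ≤ x ∧ x ≤ B.t (2 * k + 1)) := by
      rw [Filter.eventually_all_finset]
      intro k hk
      rcases key2 k with h | h
      · exact absurd ⟨k, Finset.mem_range.1 hk, h⟩ hex
      · exact h
    filter_upwards [this] with x hx
    apply B.fn_of_notMem
    rw [B.mem_supp]
    rintro ⟨k, hk, h⟩
    exact hx k (Finset.mem_range.2 hk) h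

theorem BarcodeRep.fn_between (B : BarcodeRep) {k : ℕ} (h0 : 0 < k) (hk : k < 2 * B.n) {x : ℝ}
    (hx : x ∈ Ioo (B.t (k - 1)) (B.t k)) : B.fn x = if Odd k then 1 else 0 := by
  split_ifs with hodd
  · apply B.fn_of_mem
    rw [B.mem_supp]
    obtain ⟨m, rfl⟩ := hodd
    exact ⟨m, by omega, by simpa using hx.1.le, hx.2.le⟩
  · apply B.fn_of_notMem
    rw [B.mem_supp]
    rintro ⟨m, hm, h1, h2⟩
    rw [Nat.not_odd_iff_even] at hodd
    obtain ⟨l, rfl⟩ := hodd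
    rcases le_or_gt l m with h | h
    · have := B.t_le (show l + l ≤ 2 * m by omega) (by omega)
      linarith [hx.2]
    · have := B.t_le (show 2 * m + 1 ≤ l + l - 1 by omega) (by omega)
      linarith [hx.1]

theorem BarcodeRep.TV_le (B : BarcodeRep) : TV B.fn ≤ ENNReal.ofReal (2 * B.n) := by
  set G : ℝ → ℝ := fun x => ∑ k ∈ Finset.range B.n,
    ((if B.t (2 * k) ≤ x then (1:ℝ) else 0) + (if B.t (2 * k + 1) < x then (1:ℝ) else 0)) with hG
  have hterm : ∀ x y : ℝ, x ≤ y → ∀ k,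
      ((if B.t (2 * k) ≤ x then (1:ℝ) else 0) + (if B.t (2 * k + 1) < x then (1:ℝ) else 0)) ≤
      ((if B.t (2 * k) ≤ y then (1:ℝ) else 0) + (if B.t (2 * k + 1) < y then (1:ℝ) else 0)) := by
    intro x y hxy k
    apply add_le_add
    · split_ifs <;> first | linarith | norm_num
    · split_ifs <;> first | linarith | norm_num
  have hmono : ∀ x y, x ≤ y → G x ≤ G y := fun x y hxy =>
    Finset.sum_le_sum fun k _ => hterm x y hxy k
  have h0 : ∀ x, 0 ≤ G x := fun x => Finset.sum_nonneg fun k _ => by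
    split_ifs <;> norm_num
  have h1 : ∀ x, G x ≤ 2 * B.n := by
    intro x
    have : G x ≤ ∑ k ∈ Finset.range B.n, (2:ℝ) := Finset.sum_le_sum fun k _ => by
      split_ifs <;> norm_num
    simp at this
    linarith
  have hone : ∀ x y, x ≤ y → B.fn x ≠ B.fn y → 1 ≤ G y - G x := by
    intro x y hxy hne
    have : ∃ k ∈ Finset.range B.n,
      ((if B.t (2 * k) ≤ x then (1:ℝ) else 0) + (if B.t (2 * k + 1) < x then (1:ℝ) else 0)) + 1 ≤
      ((if B.t (2 * k) ≤ y then (1:ℝ) else 0) + (if B.t (2 * k + 1) < y then (1:ℝ) else 0)) := by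
      by_cases hx : x ∈ B.supp
      · have hy : y ∉ B.supp := fun hy => hne (by rw [B.fn_of_mem hx, B.fn_of_mem hy])
        obtain ⟨k, hk, h2, h3⟩ := (B.mem_supp x).1 hx
        refine ⟨k, Finset.mem_range.2 hk, ?_⟩
        have h4 : B.t (2 * k + 1) < y := by
          by_contra h
          exact hy ((B.mem_supp y).2 ⟨k, hk, by linarith, not_lt.1 h⟩)
        rw [if_pos h2, if_neg (not_lt.2 h3), if_pos (h2.trans hxy), if_pos h4]
        norm_num
      · have hy : y ∈ B.supp := by
          by_contra hy
          exact hne (by rw [B.fn_of_notMem hx, B.fn_of_notMem hy])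
        obtain ⟨k, hk, h2, h3⟩ := (B.mem_supp y).1 hy
        refine ⟨k, Finset.mem_range.2 hk, ?_⟩
        have h4 : ¬ B.t (2 * k) ≤ x := by
          intro h
          exact hx ((B.mem_supp x).2 ⟨k, hk, h, by linarith⟩)
        rw [if_pos h2, if_neg (not_lt.2 h3), if_neg h4, if_neg (by linarith)]
        norm_num
    obtain ⟨k, hk, hk1⟩ := this
    rw [hG]
    simp only
    rw [← Finset.sum_sub_distrib]
    refine le_trans ?_ (Finset.single_le_sum (f := fun k =>
      ((if B.t (2 * k) ≤ y then (1:ℝ) else 0) + (if B.t (2 * k + 1) < y then (1:ℝ) else 0)) -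
      ((if B.t (2 * k) ≤ x then (1:ℝ) else 0) + (if B.t (2 * k + 1) < x then (1:ℝ) else 0)))
      (fun k _ => by have := hterm x y hxy k; linarith) hk)
    linarith
  have hed : ∀ x y, x ≤ y → edist (B.fn y) (B.fn x) ≤ ENNReal.ofReal (G y - G x) := by
    intro x y hxy
    by_cases h : B.fn x = B.fn y
    · rw [h, edist_self]; exact zero_le
    · have := hone x y hxy h
      rw [edist_dist, Real.dist_eq]
      apply ENNReal.ofReal_le_ofReal
      refine le_trans ?_ this
      rcases B.fn_cases x with hx | hx <;> rcases B.fn_cases y with hy | hy <;> rw [hx, hy] <;> norm_num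
  unfold TV
  apply iSup_le
  rintro ⟨n, w, hw, -⟩
  calc ∑ i ∈ Finset.range n, edist (B.fn (w (i + 1))) (B.fn (w i))
      ≤ ∑ i ∈ Finset.range n, ENNReal.ofReal (G (w (i+1)) - G (w i)) :=
        Finset.sum_le_sum fun i _ => hed _ _ (hw (Nat.le_succ i))
    _ = ENNReal.ofReal (∑ i ∈ Finset.range n, (G (w (i+1)) - G (w i))) := by
        rw [ENNReal.ofReal_sum_of_nonneg]
        intro i _
        have := hmono _ _ (hw (Nat.le_succ i))
        linarith
    _ ≤ ENNReal.ofReal (2 * B.n) := by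
        apply ENNReal.ofReal_le_ofReal
        rw [Finset.sum_range_sub (fun i => G (w i))]
        linarith [h0 (w 0), h1 (w n)]

/-- Lower bound on the variation of `u`: `D` is the set of intervals of `z` missed by `u`. -/
theorem TV_lower (Z U : BarcodeRep) : ∃ D : Finset ℕ,
    (∀ k ∈ D, 0 < k ∧ k < 2 * Z.n ∧ ∀ x ∈ Ioo (Z.t (k - 1)) (Z.t k), U.fn x ≠ Z.fn x) ∧
    ENNReal.ofReal (2 * Z.n) ≤ TV U.fn + ENNReal.ofReal (2 * D.card) := by
  classical
  set D : Finset ℕ := (Finset.range (2 * Z.n)).filter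
    fun k => 0 < k ∧ ∀ x ∈ Ioo (Z.t (k - 1)) (Z.t k), U.fn x ≠ Z.fn x with hD
  have hDm : ∀ k, k ∈ D ↔ k < 2 * Z.n ∧ 0 < k ∧
      ∀ x ∈ Ioo (Z.t (k - 1)) (Z.t k), U.fn x ≠ Z.fn x := by
    intro k; rw [hD, Finset.mem_filter, Finset.mem_range]
  refine ⟨D, fun k hk => ?_, ?_⟩
  · have := (hDm k).1 hk
    exact ⟨this.2.1, this.1, this.2.2⟩
  have hex : ∀ k, ∃ p : ℝ, (2 * Z.n ≤ k → p = 2) ∧ (k = 0 → 0 < 2 * Z.n → p = -1) ∧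
      (0 < k → k < 2 * Z.n → p ∈ Ioo (Z.t (k - 1)) (Z.t k)) ∧
      (k ≤ 2 * Z.n → k ∉ D → U.fn p = if Odd k then 1 else 0) := by
    intro k
    rcases le_or_gt (2 * Z.n) k with h | h
    · refine ⟨2, fun _ => rfl, fun _ _ => by omega, fun _ _ => by omega, fun h' _ => ?_⟩
      have : k = 2 * Z.n := by omega
      rw [U.fn_gt (by norm_num), if_neg]
      rw [this, Nat.not_odd_iff_even]
      exact even_two_mul _
    rcases Nat.eq_zero_or_pos k with h0 | h0
    · refine ⟨-1, fun _ => by omega, fun _ _ => rfl, fun _ _ => by omega, fun _ _ => ?_⟩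
      rw [U.fn_neg (by norm_num), if_neg]
      rw [h0]; simp
    have hlt : Z.t (k - 1) < Z.t k := Z.t_lt (by omega) h
    by_cases hk : k ∈ D
    · refine ⟨(Z.t (k - 1) + Z.t k) / 2, fun _ => by omega, fun _ _ => by omega,
        fun _ _ => ⟨by linarith, by linarith⟩, fun _ h' => absurd hk h'⟩
    · have hk2 := hk
      rw [hDm] at hk2
      push Not at hk2
      obtain ⟨x, hx, hxe⟩ := hk2 h h0
      refine ⟨x, fun _ => by omega, fun _ _ => by omega, fun _ _ => hx, fun _ _ => ?_⟩
      rw [hxe, Z.fn_between h0 h hx]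
  choose y hy1 hy2 hy3 hy4 using hex
  have hmono : Monotone y := by
    apply monotone_nat_of_le_succ
    intro k
    rcases le_or_gt (2 * Z.n) k with h | h
    · rw [hy1 k h, hy1 (k + 1) (by omega)]
    have ha : y k ≤ Z.t k := by
      rcases Nat.eq_zero_or_pos k with h0 | h0
      · rw [hy2 k h0 (by omega)]
        have := Z.t_nonneg h
        linarith
      · exact (hy3 k h0 h).2.le
    have hb : Z.t k ≤ y (k + 1) := by
      rcases le_or_gt (2 * Z.n) (k + 1) with h' | h'
      · rw [hy1 _ h']
        have := Z.t_le_one h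
        linarith
      · have := (hy3 (k + 1) (by omega) h').1
        simpa using this.le
    exact ha.trans hb
  set d : ℕ → ENNReal := fun k => if k ∈ D then 1 else 0 with hd
  have hsum := eVariationOn.sum_le (f := U.fn) (s := Set.univ) (n := 2 * Z.n) hmono (fun _ => mem_univ _)
  have hstep : ∀ k ∈ Finset.range (2 * Z.n),
      (1 : ENNReal) ≤ edist (U.fn (y (k + 1))) (U.fn (y k)) + (d k + d (k + 1)) := by
    intro k hk
    rw [Finset.mem_range] at hk
    by_cases h1 : k ∈ D
    · have : d k = 1 := by simp [hd, h1]
      rw [this]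
      exact le_add_left le_self_add
    by_cases h2 : k + 1 ∈ D
    · have : d (k + 1) = 1 := by simp [hd, h2]
      rw [this]
      exact le_add_left le_add_self
    rw [hy4 k hk.le h1, hy4 (k + 1) hk h2]
    refine le_add_right ?_
    by_cases ho : Odd k
    · rw [if_pos ho, if_neg (by rw [Nat.not_odd_iff_even]; exact ho.add_one)]
      simp [edist_dist]
    · rw [if_neg ho, if_pos (by rw [Nat.not_odd_iff_even] at ho; exact ho.add_one)]
      simp [edist_dist]
  have hS := Finset.sum_le_sum hstep
  rw [Finset.sum_add_distrib, Finset.sum_add_distrib] at hS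
  have hdsum : ∀ N, ∑ k ∈ Finset.range N, d k ≤ D.card := by
    intro N
    rw [hd, Finset.sum_boole]
    gcongr
    intro k hk
    exact (Finset.mem_filter.1 hk).2
  have hdsum2 : ∑ k ∈ Finset.range (2 * Z.n), d (k + 1) ≤ D.card := by
    refine le_trans ?_ (hdsum (2 * Z.n + 1))
    rw [Finset.sum_range_succ']
    exact le_self_add
  have e1 : ENNReal.ofReal (2 * Z.n) = ∑ k ∈ Finset.range (2 * Z.n), (1 : ENNReal) := by
    rw [ENNReal.ofReal_mul (by norm_num)]
    simp
  have e2 : ENNReal.ofReal (2 * D.card) = (D.card : ENNReal) + D.card := by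
    rw [ENNReal.ofReal_mul (by norm_num)]
    simp [two_mul]
  rw [e1, e2]
  exact hS.trans (add_le_add hsum (add_le_add (hdsum _) hdsum2))

theorem statement5 (σ ω lam : ℝ) (hσ : 0 < σ) (hσω : σ ≤ ω / 2) (hω : 0 < ω)
    (i j : ℝ) (hi : i = 0 ∨ i = 1) (hj : j = 0 ∨ j = 1)
    (z : ℝ → ℝ) (hz : IsBarcodeW z ω) (hzij : InBij z i j) (hlam : 0 < lam)
    (hcond : 2 / lam + 21 / 15 * σ < ω) :
    ∀ u : ℝ → ℝ, IsBarcode u → InBij u i j → ¬ u =ᵐ[volume] z →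
      Fker lam (hatKernel σ) (conv (hatKernel σ) z) z <
        Fker lam (hatKernel σ) (conv (hatKernel σ) z) u := by
  rintro u ⟨U, rfl⟩ - hne
  obtain ⟨Z, rfl, hW⟩ := hz
  obtain ⟨D, hD, hTV⟩ := TV_lower Z U
  set v : ℝ → ℝ := fun x => U.fn x - Z.fn x with hv
  have hvm : Measurable v := U.measurable_fn.sub Z.measurable_fn
  have hvb : ∀ y, |v y| ≤ 1 := by
    intro y
    simp only [hv]
    rcases U.fn_cases y with h | h <;> rcases Z.fn_cases y with h' | h' <;> rw [h, h'] <;> norm_num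
  have habs : ∀ (B : BarcodeRep) (y : ℝ), |B.fn y| ≤ 1 := by
    intro B y
    rcases B.fn_cases y with h | h <;> rw [h] <;> norm_num
  have hconv : ∀ x, conv (hatKernel σ) U.fn x - conv (hatKernel σ) Z.fn x =
      ∫ y, hatKernel σ (x - y) * v y := by
    intro x
    unfold conv
    rw [← integral_sub (hat_mul_integrable σ x hσ _ U.measurable_fn (habs U))
      (hat_mul_integrable σ x hσ _ Z.measurable_fn (habs Z))]
    simp only [hv, mul_sub]
  have hfid : fidelity (conv (hatKernel σ) U.fn) (conv (hatKernel σ) Z.fn) =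
      ∫⁻ x, ENNReal.ofReal ((∫ y, hatKernel σ (x - y) * v y) ^ 2) := by
    unfold fidelity
    simp only [hconv]
  have hmain : ENNReal.ofReal (2 * D.card) <
      ENNReal.ofReal lam * fidelity (conv (hatKernel σ) U.fn) (conv (hatKernel σ) Z.fn) := by
    rw [hfid]
    rcases D.eq_empty_or_nonempty with hDe | hDne
    · rw [hDe]
      simp only [Finset.card_empty, Nat.cast_zero, mul_zero, ENNReal.ofReal_zero]
      apply ENNReal.mul_pos (ENNReal.ofReal_pos.2 hlam).ne'
      apply (fid_pos σ hσ v hvm _ _ _ _).ne'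
      · intro a
        obtain ⟨c, hc⟩ := U.fn_right a
        obtain ⟨c', hc'⟩ := Z.fn_right a
        refine ⟨c - c', ?_⟩
        filter_upwards [hc, hc'] with x h h'
        simp only [hv, h, h']
      · intro x hx
        simp only [hv, U.fn_neg hx, Z.fn_neg hx, sub_self]
      · intro x hx
        simp only [hv, U.fn_gt hx, Z.fn_gt hx, sub_self]
      · intro h
        apply hne
        filter_upwards [h] with x hx
        exact sub_eq_zero.1 hx
    · have hdisj : Set.PairwiseDisjoint (↑D : Set ℕ) (fun k => Ioo (Z.t (k - 1)) (Z.t k)) := by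
        have aux : ∀ k ∈ D, ∀ l ∈ D, k < l →
            Disjoint (Ioo (Z.t (k - 1)) (Z.t k)) (Ioo (Z.t (l - 1)) (Z.t l)) := by
          intro k hk l hl hkl
          rw [Set.disjoint_left]
          intro x hx hx'
          have := Z.t_le (show k ≤ l - 1 by omega) (by have := (hD l hl).2.1; omega)
          linarith [hx.2, hx'.1]
        intro k hk l hl hkl
        rcases lt_or_gt_of_ne hkl with h | h
        · exact aux k hk l hl h
        · exact (aux l hl k hk h).symm
      have hlow : (D.card : ENNReal) * ENNReal.ofReal (ω - 4 / 3 * σ) ≤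
          ∫⁻ x, ENNReal.ofReal ((∫ y, hatKernel σ (x - y) * v y) ^ 2) := by
        refine le_trans ?_ (setLIntegral_le_lintegral (⋃ k ∈ D, Ioo (Z.t (k - 1)) (Z.t k)) _)
        rw [lintegral_biUnion_finset hdisj (fun _ _ => measurableSet_Ioo), ← nsmul_eq_mul]
        apply Finset.card_nsmul_le_sum
        intro k hk
        obtain ⟨hk0, hk1, hk2⟩ := hD k hk
        have hwid : ω ≤ Z.t k - Z.t (k - 1) := by
          rcases Nat.even_or_odd' k with ⟨m, rfl | rfl⟩
          · have := hW.2.1 (m - 1) (by omega)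
            rw [show 2 * (m - 1) + 2 = 2 * m by omega, show 2 * (m - 1) + 1 = 2 * m - 1 by omega] at this
            exact this
          · have := hW.1 m (by omega)
            simpa using this
        refine le_trans (ENNReal.ofReal_le_ofReal ?_)
          (fid_piece σ (Z.t (k - 1)) (Z.t k) (if Odd k then -1 else 1) hσ (by linarith) v hvm hvb
            (by split_ifs <;> simp) ?_)
        · linarith
        · intro x hx
          have h1 := Z.fn_between hk0 hk1 hx
          have h2 := hk2 x hx
          simp only [hv]
          rw [h1] at h2 ⊢
          split_ifs at h2 ⊢
          · rcases U.fn_cases x with h | h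
            · rw [h]; norm_num
            · exact absurd h h2
          · rcases U.fn_cases x with h | h
            · exact absurd h h2
            · rw [h]; norm_num
      refine lt_of_lt_of_le ?_ (mul_le_mul_right hlow _)
      have hc : (0:ℝ) < D.card := by exact_mod_cast hDne.card_pos
      rw [← ENNReal.ofReal_natCast, ← ENNReal.ofReal_mul hc.le, ← ENNReal.ofReal_mul hlam.le]
      have h2 : 2 < lam * (ω - 4 / 3 * σ) := by
        have : 2 / lam < ω - 4 / 3 * σ := by linarith
        rw [div_lt_iff₀ hlam] at this
        linarith
      rw [ENNReal.ofReal_lt_ofReal_iff]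
      · nlinarith
      · nlinarith
  have hz0 : Fker lam (hatKernel σ) (conv (hatKernel σ) Z.fn) Z.fn = TV Z.fn := by
    simp [Fker, fidelity]
  rw [hz0]
  refine lt_of_le_of_lt (Z.TV_le) ?_
  unfold Fker
  by_cases ht : TV U.fn = ⊤
  · rw [ht, top_add]
    exact ENNReal.ofReal_lt_top
  · exact lt_of_le_of_lt hTV (ENNReal.add_lt_add_left ht hmain)

end
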